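/- Let S be a ring, t₁,…,tₙ formal variables, S[t] = S[t₁,…,tₙ], and R an S[t]-algebra equipped with a flat S-linear connection ∇⁰: R → R⊗_{S[t]}Ω¹_{S[t]/S}, extended to the S-linear degree −1 operator ∇ on R⊗_{S[t]}Ω_{S[t]/S} (exterior algebra graded by |dtᵢ| = −1) by ∇(r·ω) = Σⱼ ∂/∂tⱼ(r)·dtⱼ∧ω where ∂/∂tⱼ = (dtⱼ)*∘∇⁰. Let δ be the Koszul contraction with Σᵢ tᵢ(dtᵢ)*. Then for every r ∈ R and ω = dt_{i₁}∧⋯∧dt_{i_p} with distinct indices, (δ∇ + ∇δ)(r·ω) = (p·1_R + δ∇⁰)(r)·ω. -/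

import Mathlib

/-!
STATEMENT 6.

Conventions.  `S[t] = S[t₁,…,tₙ]` is the polynomial ring on formal variables `tᵢ` and an
`S[t]`-algebra structure on the `S`-algebra `R` is encoded by the chosen images
`u i ∈ R` of the variables `tᵢ`.  `Ω_{S[t]/S}` is exterior on `dt₁,…,dtₙ` (in degree
`-1`), so `R ⊗_{S[t]} Ω_{S[t]/S}` is modelled as `Finset (Fin n) → R`, the component at
`I` being `R · dt_I`.  An `S`-linear connection `∇⁰ : R → R ⊗ Ω¹` is encoded by its
components `∂ j = (dt_j)* ∘ ∇⁰ : R → R`: the Leibniz rule over `S[t]` is equivalent to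
`S`-linearity of the `∂ j` together with `∂ j (u i · r) = u i · ∂ j r + δᵢⱼ r` (since
`S[t]` is generated over `S` by the `tᵢ`), and flatness (`∇² = 0`) is equivalent to the
`∂ j` commuting pairwise.  `δ` is the Koszul contraction with `Σᵢ tᵢ (dtᵢ)*` and `∇` is
the degree `-1` extension `∇(r·ω) = Σⱼ ∂ⱼ(r)·dtⱼ ∧ ω`.
-/

namespace Stmt6

open Finset

variable {S R : Type*} [CommRing S] [CommRing R] [Algebra S R] {n : ℕ}

/-- `R ⊗_{S[t]} Ω_{S[t]/S}`: the component at `I : Finset (Fin n)` is `R · dt_I`. -/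
abbrev RΩ (R : Type*) (n : ℕ) := Finset (Fin n) → R

/-- The sign `(-1)^{#{j ∈ I | j < i}}` of moving `dtᵢ` into `dt_I`. -/
def ksign (R : Type*) [CommRing R] {n : ℕ} (i : Fin n) (I : Finset (Fin n)) : R :=
  (-1 : R) ^ (I.filter (fun j => j < i)).card

/-- The Koszul contraction `δ` with `Σᵢ tᵢ(dtᵢ)*` on `R ⊗_{S[t]} Ω_{S[t]/S}`. -/
def delRΩ (u : Fin n → R) : Module.End R (RΩ R n) :=
  LinearMap.pi fun J =>
    ∑ i : Fin n,
      if i ∈ J then 0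
      else (ksign R i J * u i) • LinearMap.proj (insert i J)

/-- The extension `∇` of the connection, `∇(r · dt_I) = Σⱼ ∂ⱼ(r) · dtⱼ ∧ dt_I`. -/
def nablaRΩ (dd : Fin n → (R →ₗ[S] R)) : RΩ R n →ₗ[S] RΩ R n :=
  LinearMap.pi fun J =>
    ∑ j : Fin n,
      if j ∈ J then ksign R j J • (dd j ∘ₗ LinearMap.proj (J.erase j)) else 0

end Stmt6

namespace Stmt6

open Finset

variable {S R : Type*} [CommRing S] [CommRing R] [Algebra S R] {n : ℕ}

theorem ksign_mul_self (i : Fin n) (I : Finset (Fin n)) : ksign R i I * ksign R i I = 1 := by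
  rw [ksign, ← mul_pow]
  simp

theorem ksign_insert {i : Fin n} {I : Finset (Fin n)} (hi : i ∉ I) (j : Fin n) :
    ksign R j (insert i I) = (if i < j then -1 else 1) * ksign R j I := by
  rw [ksign, ksign, filter_insert]
  split_ifs
  · rw [card_insert_of_notMem (by simp [hi]), pow_succ']
  · rw [one_mul]

theorem ksign_insert_self (i : Fin n) (I : Finset (Fin n)) :
    ksign R i (insert i I) = ksign R i I := by
  simp [ksign, filter_insert]

theorem ksign_erase_self (i : Fin n) (I : Finset (Fin n)) :
    ksign R i (I.erase i) = ksign R i I := by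
  simp [ksign, filter_erase]

theorem ksign_mul_ksign_insert {i j : Fin n} {J : Finset (Fin n)} (hi : i ∉ J) (hj : j ∈ J) :
    ksign R i J * ksign R j (insert i J) = -(ksign R j J * ksign R i (J.erase j)) := by
  have hij : i ≠ j := fun h => hi (h ▸ hj)
  have hiJ : ksign R i J = (if j < i then -1 else 1) * ksign R i (J.erase j) := by
    rw [← ksign_insert (notMem_erase j J), insert_erase hj]
  rw [ksign_insert hi, hiJ]
  rcases hij.lt_or_gt with h | h
  · simp [h, h.not_gt, mul_comm]
  · simp [h, h.not_gt, mul_comm]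

theorem map_ksign_mul (d : R →ₗ[S] R) (i : Fin n) (I : Finset (Fin n)) (r : R) :
    d (ksign R i I * r) = ksign R i I * d r := by
  rcases neg_one_pow_eq_or R (I.filter (fun j => j < i)).card with h | h <;> simp [ksign, h]

theorem delRΩ_apply (u : Fin n → R) (f : RΩ R n) (J : Finset (Fin n)) :
    delRΩ u f J = ∑ i ∈ Jᶜ, ksign R i J * (u i * f (insert i J)) := by
  rw [delRΩ, LinearMap.pi_apply, LinearMap.sum_apply, ← sum_add_sum_compl J,
    sum_eq_zero fun i hi => by simp [hi], zero_add]
  refine sum_congr rfl fun i hi => ?_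
  rw [if_neg (mem_compl.mp hi)]
  simp [mul_assoc]

theorem nablaRΩ_apply (dd : Fin n → (R →ₗ[S] R)) (f : RΩ R n) (J : Finset (Fin n)) :
    nablaRΩ dd f J = ∑ j ∈ J, ksign R j J * dd j (f (J.erase j)) := by
  rw [nablaRΩ, LinearMap.pi_apply, LinearMap.sum_apply, ← sum_add_sum_compl J,
    sum_eq_zero (s := Jᶜ) fun i hi => by rw [if_neg (mem_compl.mp hi), LinearMap.zero_apply],
    add_zero]
  refine sum_congr rfl fun j hj => ?_
  rw [if_pos hj]
  simp

/-- The component of `(δ∇ + ∇δ) f` at `J` is `(|J| + δ∇⁰) (f J)`; flatness is not needed. -/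
theorem delRΩ_nablaRΩ_add_nablaRΩ_delRΩ_apply (u : Fin n → R) (dd : Fin n → (R →ₗ[S] R))
    (hleib : ∀ i j r, dd j (u i * r) = u i * dd j r + (if i = j then r else 0))
    (f : RΩ R n) (J : Finset (Fin n)) :
    delRΩ u (nablaRΩ dd f) J + nablaRΩ dd (delRΩ u f) J =
      (J.card : R) * f J + ∑ i : Fin n, u i * dd i (f J) := by
  have hδ : delRΩ u (nablaRΩ dd f) J = ∑ i ∈ Jᶜ, u i * dd i (f J) -
      ∑ i ∈ Jᶜ, ∑ j ∈ J, ksign R j J * ksign R i (J.erase j) *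
        (u i * dd j (f ((insert i J).erase j))) := by
    rw [delRΩ_apply, ← sum_sub_distrib]
    refine sum_congr rfl fun i hi => ?_
    rw [mem_compl] at hi
    rw [nablaRΩ_apply, sum_insert hi, ksign_insert_self, erase_insert hi, mul_add, mul_add,
      sub_eq_add_neg, mul_sum, mul_sum, ← sum_neg_distrib]
    congr 1
    · linear_combination (u i * dd i (f J)) * ksign_mul_self (R := R) i J
    · refine sum_congr rfl fun j hj => ?_
      linear_combination (u i * dd j (f ((insert i J).erase j))) *
        ksign_mul_ksign_insert (R := R) hi hj
  have hnabla : nablaRΩ dd (delRΩ u f) J = ∑ j ∈ J, (u j * dd j (f J) + f J) +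
      ∑ j ∈ J, ∑ i ∈ Jᶜ, ksign R j J * ksign R i (J.erase j) *
        (u i * dd j (f ((insert i J).erase j))) := by
    rw [nablaRΩ_apply, ← sum_add_distrib]
    refine sum_congr rfl fun j hj => ?_
    have hj' : j ∉ Jᶜ := by simpa using hj
    rw [delRΩ_apply, compl_erase, sum_insert hj', map_add, map_sum, mul_add, mul_sum,
      ksign_erase_self, insert_erase hj, map_ksign_mul, hleib, if_pos rfl]
    congr 1
    · linear_combination (u j * dd j (f J) + f J) * ksign_mul_self (R := R) j J
    · refine sum_congr rfl fun i hi => ?_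
      have hij : i ≠ j := fun h => hj' (h ▸ hi)
      rw [map_ksign_mul, hleib, if_neg hij, add_zero, mul_assoc, erase_insert_of_ne hij]
  rw [hδ, hnabla, sum_comm (s := J), sum_add_distrib, sum_const, nsmul_eq_mul,
    ← sum_add_sum_compl J]
  ring

end Stmt6

open Stmt6 in
theorem statement6
    {S R : Type*} [CommRing S] [CommRing R] [Algebra S R] {n : ℕ}
    -- the S[t]-algebra structure of R: images of the formal variables tᵢ
    (u : Fin n → R)
    -- the connection, via its components ∂ j = (dtⱼ)* ∘ ∇⁰
    (dd : Fin n → (R →ₗ[S] R))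
    -- Leibniz rule over S[t]
    (hleib : ∀ i j r, dd j (u i * r) = u i * dd j r + (if i = j then r else 0))
    -- flatness
    (hflat : ∀ i j, dd i ∘ₗ dd j = dd j ∘ₗ dd i) :
    -- for every r ∈ R and every ω = dt_{i₁} ∧ ⋯ ∧ dt_{i_p} with distinct indices
    -- (encoded as a finset I of cardinality p):
    --   (δ∇ + ∇δ)(r · ω) = (p·1_R + δ∇⁰)(r) · ω
    ∀ (I : Finset (Fin n)) (r : R),
      ((delRΩ u).restrictScalars S ∘ₗ nablaRΩ dd +
        nablaRΩ dd ∘ₗ (delRΩ u).restrictScalars S) (Pi.single I r) =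
      Pi.single I ((I.card : R) * r + ∑ i : Fin n, u i * dd i r) := by
  intro I r
  ext J
  refine (delRΩ_nablaRΩ_add_nablaRΩ_delRΩ_apply u dd hleib _ J).trans ?_
  rcases eq_or_ne J I with rfl | h
  · simp
  · simp [h]
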